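/- A matching M in a graph G is maximum if and only if there is no M-augmenting path in G (a path whose edges alternate between E\M and M and whose endpoints are both unmatched by M). -/

import Mathlib

/-- `M` is a matching of the simple graph `G`: a set of edges of `G`,
no two of which share a vertex. -/
def IsMatching {V : Type*} (G : SimpleGraph V) [Fintype V] [DecidableEq V]
    [DecidableRel G.Adj] (M : Finset (Sym2 V)) : Prop :=
  M ⊆ G.edgeFinset ∧ ∀ e ∈ M, ∀ f ∈ M, e ≠ f → ∀ v : V, v ∈ e → v ∉ f

/-- A vertex is unmatched by `M` if it is an endpoint of no edge of `M`. -/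
def Unmatched {V : Type*} (M : Finset (Sym2 V)) (v : V) : Prop :=
  ∀ e ∈ M, v ∉ e

/-- The list of edges traversed by a list of vertices. -/
def pathEdges {V : Type*} (p : List V) : List (Sym2 V) :=
  List.zipWith (fun a b => s(a, b)) p p.tail

/-- `p` is a (vertex list of a) path in `G`: distinct vertices, consecutive ones adjacent. -/
def IsPathList {V : Type*} (G : SimpleGraph V) (p : List V) : Prop :=
  p.Nodup ∧ p.Chain' G.Adj

/-- The edges along `p` alternate between membership and non-membership in `M`. -/
def AlternatingList {V : Type*} [DecidableEq V] (M : Finset (Sym2 V)) (p : List V) : Prop :=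
  ∀ i : ℕ, (h : i + 1 < (pathEdges p).length) →
    ((pathEdges p)[i]'(Nat.lt_of_succ_lt h) ∈ M ↔ (pathEdges p)[i + 1]'h ∉ M)

/-- An `M`-augmenting path in `G`: a path whose edges alternate between `E \ M` and `M`
and whose two endpoint vertices are unmatched by `M`. -/
def IsAugmentingPath {V : Type*} (G : SimpleGraph V) [Fintype V] [DecidableEq V]
    (M : Finset (Sym2 V)) (p : List V) : Prop :=
  IsPathList G p ∧ 2 ≤ p.length ∧ AlternatingList M p ∧
    (∃ u, p.head? = some u ∧ Unmatched M u) ∧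
    (∃ w, p.getLast? = some w ∧ Unmatched M w)

theorem mem_of_mem_pathEdges {V : Type*} (p : List V) (e : Sym2 V) (he : e ∈ pathEdges p)
    (v : V) (hv : v ∈ e) : v ∈ p := by
  unfold pathEdges at he
  obtain ⟨i, hi, rfl⟩ := List.getElem_of_mem he
  rw [List.getElem_zipWith, Sym2.mem_iff] at hv
  rcases hv with rfl | rfl
  · exact List.getElem_mem _
  · exact List.mem_of_mem_tail (List.getElem_mem _)

theorem augment_aux {V : Type*} [Fintype V] [DecidableEq V] (G : SimpleGraph V)
    [DecidableRel G.Adj] : ∀ (n : ℕ) (p : List V), p.length ≤ n → ∀ (M : Finset (Sym2 V)),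
      IsMatching G M → IsAugmentingPath G M p →
      ∃ M' : Finset (Sym2 V), IsMatching G M' ∧ M.card < M'.card := by
  intro n
  induction n with
  | zero =>
    intro p hp M hM hA
    have := hA.2.1
    omega
  | succ n ih =>
    intro p hp M hM hA
    obtain ⟨⟨hnd, hch0⟩, hlen, halt, ⟨u, hu, huM⟩, ⟨w, hw, hwM⟩⟩ := hA
    have hch : p.IsChain G.Adj := hch0
    clear hch0
    match p, hlen with
    | [a, b], _ =>
      simp at hu hw
      subst hu hw
      have hadj : G.Adj a b := by simpa using hch
      refine ⟨insert s(a, b) M, ⟨?_, ?_⟩, ?_⟩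
      · intro e he
        rcases Finset.mem_insert.1 he with rfl | he
        · simpa using hadj
        · exact hM.1 he
      · intro e he f hf hef v hve hvf
        rcases Finset.mem_insert.1 he with rfl | he1 <;>
        rcases Finset.mem_insert.1 hf with rfl | hf1
        · exact hef rfl
        · rcases Sym2.mem_iff.1 hve with rfl | rfl
          · exact huM _ hf1 hvf
          · exact hwM _ hf1 hvf
        · rcases Sym2.mem_iff.1 hvf with rfl | rfl
          · exact huM _ he1 hve
          · exact hwM _ he1 hve
        · exact hM.2 e he1 f hf1 hef v hve hvf
      · rw [Finset.card_insert_of_notMem]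
        · omega
        · intro h
          exact huM _ h (by simp)
    | a :: b :: c :: r, _ =>
      have hau : a = u := by simpa using hu
      subst hau
      have habM : s(a, b) ∉ M := fun h => huM _ h (by simp)
      have hbcM : s(b, c) ∈ M := by
        by_contra h
        have := halt 0 (by simp [pathEdges])
        exact habM (this.2 h)
      have hch' : G.Adj a b ∧ G.Adj b c ∧ (c :: r).IsChain G.Adj := by
        simpa [List.isChain_cons_cons] using hch
      obtain ⟨hab, hbc, hcr⟩ := hch'
      have hac : a ∉ c :: r := by
        intro h
        exact (List.nodup_cons.1 hnd).1 (List.mem_cons_of_mem _ h)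
      have hbn : b ∉ c :: r := (List.nodup_cons.1 (List.nodup_cons.1 hnd).2).1
      have hnd' : (c :: r).Nodup := (List.nodup_cons.1 (List.nodup_cons.1 hnd).2).2
      have hw' : (c :: r).getLast? = some w := by
        simpa [List.getLast?_cons_cons] using hw
      have hwmem : w ∈ c :: r := List.mem_of_getLast? hw'
      have hbU : ∀ e ∈ M, b ∈ e → e = s(b, c) := by
        intro e he hb
        by_contra hne
        exact hM.2 e he _ hbcM hne b hb (by simp)
      have hcU : ∀ e ∈ M, c ∈ e → e = s(b, c) := by
        intro e he hb
        by_contra hne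
        exact hM.2 e he _ hbcM hne c hb (by simp)
      set M1 := insert s(a, b) (M.erase s(b, c)) with hM1
      have hcard : M1.card = M.card := by
        rw [hM1, Finset.card_insert_of_notMem (fun h => habM (Finset.mem_of_mem_erase h)),
          Finset.card_erase_add_one hbcM]
      have hM1M : IsMatching G M1 := by
        refine ⟨?_, ?_⟩
        · intro e he
          rcases Finset.mem_insert.1 he with rfl | he
          · simpa using hab
          · exact hM.1 (Finset.mem_of_mem_erase he)
        · have key : ∀ f ∈ M.erase s(b, c), ∀ v ∈ s(a, b), v ∉ f := by
            intro f hf v hv hvf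
            obtain ⟨h1, h2⟩ := Finset.mem_erase.1 hf
            rcases Sym2.mem_iff.1 hv with rfl | rfl
            · exact huM _ h2 hvf
            · exact h1 (hbU _ h2 hvf)
          intro e he f hf hef v hve hvf
          rcases Finset.mem_insert.1 he with rfl | he <;>
          rcases Finset.mem_insert.1 hf with rfl | hf
          · exact hef rfl
          · exact key f hf v hve hvf
          · exact key e he v hvf hve
          · exact hM.2 e (Finset.mem_of_mem_erase he) f (Finset.mem_of_mem_erase hf) hef v hve hvf
      have hmem : ∀ e ∈ pathEdges (c :: r), (e ∈ M1 ↔ e ∈ M) := by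
        intro e he
        have h1 : e ≠ s(a, b) := by
          rintro rfl
          exact hac (mem_of_mem_pathEdges _ _ he a (by simp))
        have h2 : e ≠ s(b, c) := by
          rintro rfl
          exact hbn (mem_of_mem_pathEdges _ _ he b (by simp))
        simp [hM1, h1, h2]
      obtain ⟨M', h1, h2⟩ := ih (c :: r) (by simp at hp ⊢; omega) M1 hM1M (by
        refine ⟨⟨hnd', hcr⟩, ?_, ?_, ⟨c, by simp, ?_⟩, ⟨w, hw', ?_⟩⟩
        · cases r with
          | nil =>
            simp at hw'
            subst hw'
            exact absurd (by simp) (hwM _ hbcM)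
          | cons x t => simp
        · intro i h
          rw [hmem _ (List.getElem_mem _), hmem _ (List.getElem_mem _)]
          have h' : (i + 2) + 1 < (pathEdges (a :: b :: c :: r)).length := by
            simp [pathEdges] at h ⊢; omega
          exact halt (i + 2) h'
        · intro e he hce
          rcases Finset.mem_insert.1 he with rfl | he
          · rcases Sym2.mem_iff.1 hce with rfl | rfl
            · simp at hac
            · simp at hbn
          · obtain ⟨h1, h2⟩ := Finset.mem_erase.1 he
            exact h1 (hcU _ h2 hce)
        · intro e he hce
          rcases Finset.mem_insert.1 he with rfl | he
          · rcases Sym2.mem_iff.1 hce with rfl | rfl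
            · exact hac hwmem
            · exact hbn hwmem
          · exact hwM _ (Finset.mem_of_mem_erase he) hce)
      exact ⟨M', h1, by omega⟩

/-- Function form of an augmenting path whose edges come alternately from `M'` and `M`. -/
def FunPath {V : Type*} (M M' : Finset (Sym2 V)) (n : ℕ) (f : ℕ → V) : Prop :=
  (∀ i j, i ≤ 2 * n + 1 → j ≤ 2 * n + 1 → f i = f j → i = j) ∧
  (∀ i, i ≤ n → s(f (2 * i), f (2 * i + 1)) ∈ M' ∧ s(f (2 * i), f (2 * i + 1)) ∉ M) ∧
  (∀ i, i < n → s(f (2 * i + 1), f (2 * i + 2)) ∈ M) ∧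
  Unmatched M (f 0) ∧ Unmatched M (f (2 * n + 1))

theorem FunPath.rev {V : Type*} {M M' : Finset (Sym2 V)} {n : ℕ} {f : ℕ → V}
    (h : FunPath M M' n f) : FunPath M M' n (fun i => f (2 * n + 1 - i)) := by
  obtain ⟨h1, h2, h3, h4, h5⟩ := h
  refine ⟨?_, ?_, ?_, by simpa using h5, by simpa using h4⟩
  · intro i j hi hj hij
    have := h1 _ _ (by omega) (by omega) hij
    omega
  · intro i hi
    have := h2 (n - i) (by omega)
    have e1 : 2 * n + 1 - 2 * i = 2 * (n - i) + 1 := by omega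
    have e2 : 2 * n + 1 - (2 * i + 1) = 2 * (n - i) := by omega
    simp only [e1, e2]
    rw [Sym2.eq_swap]
    exact this
  · intro i hi
    have := h3 (n - i - 1) (by omega)
    have e1 : 2 * n + 1 - (2 * i + 1) = 2 * (n - i - 1) + 2 := by omega
    have e2 : 2 * n + 1 - (2 * i + 2) = 2 * (n - i - 1) + 1 := by omega
    simp only [e1, e2]
    rw [Sym2.eq_swap]
    exact this

theorem card_cover {V : Type*} [Fintype V] [DecidableEq V] (G : SimpleGraph V)
    [DecidableRel G.Adj] (M : Finset (Sym2 V)) (hM : IsMatching G M) :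
    (M.biUnion Sym2.toFinset).card = 2 * M.card := by
  rw [Finset.card_biUnion]
  · rw [Finset.sum_const_nat (m := 2), mul_comm]
    intro e he
    refine Sym2.card_toFinset_of_not_isDiag e ?_
    have := hM.1 he
    rw [SimpleGraph.mem_edgeFinset] at this
    exact G.not_isDiag_of_mem_edgeSet this
  · intro e he f hf hef
    show Disjoint _ _
    rw [Finset.disjoint_left]
    intro v hv hv'
    rw [Sym2.mem_toFinset] at hv hv'
    exact hM.2 e he f hf hef v hv hv'

theorem IsMatching.mono {V : Type*} [Fintype V] [DecidableEq V] {G : SimpleGraph V}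
    [DecidableRel G.Adj] {M N : Finset (Sym2 V)} (hM : IsMatching G M) (h : N ⊆ M) :
    IsMatching G N :=
  ⟨h.trans hM.1, fun e he f hf => hM.2 e (h he) f (h hf)⟩

theorem exists_funPath {V : Type*} [Fintype V] [DecidableEq V] (G : SimpleGraph V)
    [DecidableRel G.Adj] : ∀ (k : ℕ) (M M' : Finset (Sym2 V)), M.card = k →
      IsMatching G M → IsMatching G M' → M.card < M'.card →
      ∃ n f, FunPath M M' n f := by
  intro k
  induction k with
  | zero | succ k ih => ?_
  all_goals
    intro M M' hk hM hM' hlt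
    have hex : ∃ a, a ∈ M'.biUnion Sym2.toFinset ∧ a ∉ M.biUnion Sym2.toFinset := by
      by_contra hcon
      push Not at hcon
      have := Finset.card_le_card (show M'.biUnion Sym2.toFinset ⊆ _ from hcon)
      rw [card_cover G M hM, card_cover G M' hM'] at this
      omega
    obtain ⟨a, ha', ha⟩ := hex
    have haM : Unmatched M a := by
      intro e he hae
      exact ha (Finset.mem_biUnion.2 ⟨e, he, Sym2.mem_toFinset.2 hae⟩)
    obtain ⟨e, he, hae⟩ := Finset.mem_biUnion.1 ha'
    rw [Sym2.mem_toFinset] at hae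
    obtain ⟨b, rfl⟩ := Sym2.mem_iff_exists.1 hae
    have hab : a ≠ b := by
      have := hM'.1 he
      simp at this
      exact this.ne
    have habM : s(a, b) ∉ M := fun h => haM _ h (by simp)
    by_cases hbM : Unmatched M b
    · refine ⟨0, fun i => if i = 0 then a else b, ?_, ?_, ?_, ?_, ?_⟩
      · intro i j hi hj hij
        have h1 : i = 0 ∨ i = 1 := by omega
        have h2 : j = 0 ∨ j = 1 := by omega
        rcases h1 with rfl | rfl <;> rcases h2 with rfl | rfl <;> simp_all
      · intro i hi
        have : i = 0 := by omega
        subst this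
        simpa using ⟨he, habM⟩
      · intro i hi
        omega
      · simpa using haM
      · simpa using hbM
    unfold Unmatched at hbM
    push Not at hbM
    obtain ⟨e', he', hbe'⟩ := hbM
    obtain ⟨c, rfl⟩ := Sym2.mem_iff_exists.1 hbe'
  · rw [Finset.card_eq_zero] at hk
    simp [hk] at he'
  have hbc : b ≠ c := by
    have := hM.1 he'
    simp at this
    exact this.ne
  have hac : a ≠ c := by
    rintro rfl
    exact haM _ he' (by simp)
  have hbU : ∀ e ∈ M, b ∈ e → e = s(b, c) := by
    intro e he hb
    by_contra hne
    exact hM.2 e he _ he' hne b hb (by simp)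
  have hcU : ∀ e ∈ M, c ∈ e → e = s(b, c) := by
    intro e he hb
    by_contra hne
    exact hM.2 e he _ he' hne c hb (by simp)
  have hN : ∀ e ∈ M'.erase s(a, b), a ∉ e ∧ b ∉ e := by
    intro e h
    obtain ⟨h1, h2⟩ := Finset.mem_erase.1 h
    exact ⟨fun h => hM'.2 e h2 _ he h1 a h (by simp), fun h => hM'.2 e h2 _ he h1 b h (by simp)⟩
  have hcN : Unmatched (M.erase s(b, c)) c := by
    intro e h hc
    obtain ⟨h1, h2⟩ := Finset.mem_erase.1 h
    exact h1 (hcU _ h2 hc)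
  have hc1 := Finset.card_erase_add_one he
  have hc2 := Finset.card_erase_add_one he'
  obtain ⟨n, f, hf⟩ := ih (M.erase s(b, c)) (M'.erase s(a, b)) (by omega)
    (hM.mono (Finset.erase_subset _ _)) (hM'.mono (Finset.erase_subset _ _)) (by omega)
  -- every vertex of a path avoids `a` and `b`
  have hav : ∀ g, FunPath (M.erase s(b, c)) (M'.erase s(a, b)) n g →
      ∀ j, j ≤ 2 * n + 1 → g j ≠ a ∧ g j ≠ b := by
    intro g hg j hj
    have := hN _ (hg.2.1 (j / 2) (by omega)).1
    simp only [Sym2.mem_iff, not_or] at this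
    rcases Nat.mod_two_eq_zero_or_one j with h | h
    · have e : 2 * (j / 2) = j := by omega
      rw [e] at this
      exact ⟨Ne.symm this.1.1, Ne.symm this.2.1⟩
    · have e : 2 * (j / 2) + 1 = j := by omega
      rw [e] at this
      exact ⟨Ne.symm this.1.2, Ne.symm this.2.2⟩
  have hM'e : ∀ e ∈ M'.erase s(a, b), e ∉ M.erase s(b, c) → e ∈ M' ∧ e ∉ M := by
    intro e h1 h2
    refine ⟨Finset.mem_of_mem_erase h1, fun h => h2 (Finset.mem_erase.2 ⟨?_, h⟩)⟩
    rintro rfl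
    exact (hN _ h1).2 (by simp)
  have hUn : ∀ v, v ≠ b → v ≠ c → Unmatched (M.erase s(b, c)) v → Unmatched M v := by
    intro v h1 h2 h e he hv
    refine h e (Finset.mem_erase.2 ⟨?_, he⟩) hv
    rintro rfl
    rcases Sym2.mem_iff.1 hv with h | h
    · exact h1 h
    · exact h2 h
  -- extension of a path that starts at `c`
  have hext : ∀ g, FunPath (M.erase s(b, c)) (M'.erase s(a, b)) n g → g 0 = c →
      ∃ n f, FunPath M M' n f := by
    intro g hg hgc
    have hg' := hav g hg
    obtain ⟨h1, h2, h3, h4, h5⟩ := hg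
    refine ⟨n + 1, fun i => if i = 0 then a else if i = 1 then b else g (i - 2), ?_, ?_, ?_, ?_, ?_⟩
    · intro i j hi hj hij
      have hgi := hg' (i - 2) (by omega)
      have hgj := hg' (j - 2) (by omega)
      have := h1 (i - 2) (j - 2) (by omega) (by omega)
      simp only at hij
      split_ifs at hij
      · omega
      · exact absurd hij hab
      · exact absurd hij.symm hgj.1
      · exact absurd hij.symm hab
      · omega
      · exact absurd hij.symm hgj.2
      · exact absurd hij hgi.1
      · exact absurd hij hgi.2
      · have := this hij
        omega
    · intro i hi
      rcases i with _ | i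
      · simpa using ⟨he, habM⟩
      · have := h2 i (by omega)
        exact hM'e _ this.1 this.2
    · intro i hi
      rcases i with _ | i
      · simpa [hgc] using he'
      · exact Finset.mem_of_mem_erase (h3 i (by omega))
    · simpa using haM
    · have e : g (2 * n + 1) ≠ c := by
        intro h
        have := h1 _ _ (by omega) (by omega) (h.trans hgc.symm)
        omega
      exact hUn _ (hg' _ le_rfl).2 e h5
  by_cases hs : f 0 = c
  · exact hext f hf hs
  by_cases ht : f (2 * n + 1) = c
  · exact hext _ hf.rev (by simpa using ht)
  have hf' := hav f hf
  obtain ⟨h1, h2, h3, h4, h5⟩ := hf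
  exact ⟨n, f, h1, fun i hi => hM'e _ (h2 i hi).1 (h2 i hi).2,
    fun i hi => Finset.mem_of_mem_erase (h3 i hi),
    hUn _ (hf' 0 (by omega)).2 hs h4, hUn _ (hf' _ le_rfl).2 ht h5⟩

theorem FunPath.isAugmentingPath {V : Type*} [Fintype V] [DecidableEq V] {G : SimpleGraph V}
    [DecidableRel G.Adj] {M M' : Finset (Sym2 V)} (hM : IsMatching G M) (hM' : IsMatching G M')
    {n : ℕ} {f : ℕ → V} (h : FunPath M M' n f) :
    IsAugmentingPath G M ((List.range (2 * n + 2)).map f) := by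
  obtain ⟨h1, h2, h3, h4, h5⟩ := h
  refine ⟨⟨?_, ?_⟩, by simp, ?_, ⟨f 0, ?_, h4⟩, ⟨f (2 * n + 1), ?_, h5⟩⟩
  · refine List.Nodup.map_on ?_ List.nodup_range
    intro x hx y hy hxy
    rw [List.mem_range] at hx hy
    exact h1 x y (by omega) (by omega) hxy
  · show List.IsChain _ _
    rw [List.isChain_iff_getElem]
    intro i hi
    simp only [List.length_map, List.length_range] at hi
    simp only [List.getElem_map, List.getElem_range]
    rcases Nat.even_or_odd' i with ⟨j, rfl | rfl⟩
    · have := hM'.1 (h2 j (by omega)).1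
      simpa using this
    · have := hM.1 (h3 j (by omega))
      simpa using this
  · intro i hi
    have hi' : i + 2 < 2 * n + 2 := by
      simp [pathEdges] at hi
      omega
    simp only [pathEdges, List.getElem_zipWith, List.getElem_tail, List.getElem_map,
      List.getElem_range]
    rcases Nat.even_or_odd' i with ⟨j, rfl | rfl⟩
    · have a1 := (h2 j (by omega)).2
      have a2 := h3 j (by omega)
      exact ⟨fun h => absurd h a1, fun h => absurd a2 h⟩
    · have a1 := h3 j (by omega)
      have a2 := (h2 (j + 1) (by omega)).2
      exact ⟨fun _ => a2, fun _ => a1⟩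
  · simp [List.range_succ_eq_map]
  · simp [List.range_succ]

/-- **Berge's theorem.** A matching `M` in a finite simple graph `G` is maximum
if and only if there is no `M`-augmenting path in `G`. -/
theorem berge {V : Type*} [Fintype V] [DecidableEq V] (G : SimpleGraph V)
    [DecidableRel G.Adj] (M : Finset (Sym2 V)) (hM : IsMatching G M) :
    (∀ M' : Finset (Sym2 V), IsMatching G M' → M'.card ≤ M.card) ↔
      ¬ ∃ p : List V, IsAugmentingPath G M p := by
  constructor
  · rintro h ⟨p, hp⟩
    obtain ⟨M', h1, h2⟩ := augment_aux G p.length p le_rfl M hM hp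
    exact absurd (h M' h1) (by omega)
  · intro h M' hM'
    by_contra hlt
    obtain ⟨n, f, hf⟩ := exists_funPath G M.card M M' rfl hM hM' (by omega)
    exact h ⟨_, hf.isAugmentingPath hM hM'⟩
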